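/- Pruning preserves refinement from locally consistent NAA: for any NAA S and any locally consistent NAA T, T ≤ₘ S if and only if T ≤ₘ ρ(S), where ρ(S) is the pruning of S. In particular ⟦ρ(S)⟧ = ⟦S⟧ for every NAA S. -/

import Mathlib

/-- A labelled transition system over alphabet `A`, with an image-finite
transition relation. -/
structure LTS (A : Type) : Type 1 where
  State : Type
  init : State
  trans : State → A → Set State
  image_finite : ∀ s a, (trans s a).Finite
/-- A nondeterministic acceptance automaton over alphabet `A`. -/
structure NAA (A : Type) : Type 1 where
  State : Type
  init : Set State
  Tran : State → Set (Set (A × State))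

namespace NAA

variable {A : Type}

/-- Modal refinement relation between two NAA. -/
def Refinement (S1 S2 : NAA A) (R : Set (S1.State × S2.State)) : Prop :=
  ∀ p ∈ R, ∀ M1 ∈ S1.Tran p.1, ∃ M2 ∈ S2.Tran p.2,
    (∀ q ∈ M1, ∃ r ∈ M2, q.1 = r.1 ∧ (q.2, r.2) ∈ R) ∧
    (∀ r ∈ M2, ∃ q ∈ M1, q.1 = r.1 ∧ (q.2, r.2) ∈ R)

/-- `S1 ≤ₘ S2`: there is an initialised modal refinement from `S1` to `S2`. -/
def Refines (S1 S2 : NAA A) : Prop :=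
  ∃ R, Refinement S1 S2 R ∧ ∀ s ∈ S1.init, ∃ t ∈ S2.init, (s, t) ∈ R

/-- `S1 ≡ₘ S2`: modal refinement in both directions. -/
def Equiv (S1 S2 : NAA A) : Prop := Refines S1 S2 ∧ Refines S2 S1

/-- The defining finiteness conditions of NAA: the set of initial states is
finite and every admissible transition set is a finite subset of `A × State`. -/
def Wellformed (S : NAA A) : Prop :=
  S.init.Finite ∧ ∀ s, ∀ M ∈ S.Tran s, M.Finite

end NAA
/-- An (image-finite) LTS viewed as an NAA: a singleton set of initial states and
a single admissible transition set per state. -/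
def LTS.toNAA {A : Type} (I : LTS A) : NAA A where
  State := I.State
  init := {I.init}
  Tran := fun s => {M | M = {p : A × I.State | p.2 ∈ I.trans s p.1}}

/-- The implementations (LTS models) of an NAA. -/
def NAA.impl {A : Type} (S : NAA A) : Set (LTS A) := {I | I.toNAA.Refines S}

/-- The reachable states of an NAA: the least set containing the initial states
and closed under taking targets of admissible transitions. -/
inductive NAA.Reach {A : Type} (S : NAA A) : S.State → Prop
  | init (s : S.State) (h : s ∈ S.init) : NAA.Reach S s
  | step (s : S.State) (hs : NAA.Reach S s) (M : Set (A × S.State))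
      (hM : M ∈ S.Tran s) (p : A × S.State) (hp : p ∈ M) : NAA.Reach S p.2

/-- The set `B' = pred*({s | Tran s = ∅})` of inconsistent states: the least set
containing the states without admissible transition sets and closed under
`pred(B) = {s | ∀ M ∈ Tran s, ∃ (a, t) ∈ M : t ∈ B}` (the choice of a bad
element of every `M ∈ Tran s` is presented by a choice function `f`). -/
inductive NAA.Bad {A : Type} (S : NAA A) : S.State → Prop
  | base (s : S.State) (h : S.Tran s = ∅) : NAA.Bad S s
  | step (s : S.State) (f : ∀ M ∈ S.Tran s, A × S.State)
      (hf : ∀ M (hM : M ∈ S.Tran s), f M hM ∈ M)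
      (hb : ∀ M (hM : M ∈ S.Tran s), NAA.Bad S (f M hM).2) : NAA.Bad S s

/-- The pruning `ρ S` of an NAA `S`: the inconsistent states `B'` are removed
from the states and the initial states, and only the admissible transition sets
avoiding `B'` are kept. -/
def NAA.prune {A : Type} (S : NAA A) : NAA A where
  State := {s : S.State // ¬ S.Bad s}
  init := {s | s.1 ∈ S.init}
  Tran := fun s => {M | ∃ M0 ∈ S.Tran s.1, (∀ p ∈ M0, ¬ S.Bad p.2) ∧
    M = {x : A × {u : S.State // ¬ S.Bad u} | (x.1, x.2.1) ∈ M0}}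

theorem NAA.not_bad_of_rel {A : Type} {S T : NAA A} {R : Set (T.State × S.State)}
    (hR : NAA.Refinement T S R) (hT : ∀ t, T.Reach t → (T.Tran t).Nonempty)
    {s : S.State} (hs : S.Bad s) : ∀ t, T.Reach t → (t, s) ∈ R → False := by
  induction hs with
  | base s h =>
    intro t ht hts
    obtain ⟨M1, hM1⟩ := hT t ht
    obtain ⟨M2, hM2, -⟩ := hR _ hts M1 hM1
    simp [h] at hM2
  | step s f hf hb ih =>
    intro t ht hts
    obtain ⟨M1, hM1⟩ := hT t ht
    obtain ⟨M2, hM2, -, h2⟩ := hR _ hts M1 hM1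
    obtain ⟨q, hq, -, hqr⟩ := h2 _ (hf M2 hM2)
    exact ih M2 hM2 q.2 (NAA.Reach.step t ht M1 hM1 q hq) hqr

theorem NAA.refines_prune {A : Type} {S T : NAA A}
    (hT : ∀ t, T.Reach t → (T.Tran t).Nonempty) (h : T.Refines S) : T.Refines S.prune := by
  obtain ⟨R, hR, hi⟩ := h
  refine ⟨{p | T.Reach p.1 ∧ (p.1, p.2.1) ∈ R}, ?_, ?_⟩
  · rintro ⟨t, s⟩ ⟨ht, hts⟩ M1 hM1
    obtain ⟨M2, hM2, h1, h2⟩ := hR _ hts M1 hM1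
    have hg : ∀ p ∈ M2, ¬ S.Bad p.2 := by
      intro p hp hb
      obtain ⟨q, hq, -, hqr⟩ := h2 p hp
      exact NAA.not_bad_of_rel hR hT hb q.2 (NAA.Reach.step t ht M1 hM1 q hq) hqr
    refine ⟨_, ⟨M2, hM2, hg, rfl⟩, ?_, ?_⟩
    · intro q hq
      obtain ⟨r, hr, he, hqr⟩ := h1 q hq
      exact ⟨(r.1, ⟨r.2, hg r hr⟩), hr, he, NAA.Reach.step t ht M1 hM1 q hq, hqr⟩
    · intro r hr
      obtain ⟨q, hq, he, hqr⟩ := h2 _ hr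
      exact ⟨q, hq, he, NAA.Reach.step t ht M1 hM1 q hq, hqr⟩
  · intro t ht
    obtain ⟨s, hs, hts⟩ := hi t ht
    have hr := NAA.Reach.init t ht
    exact ⟨⟨s, fun hb => NAA.not_bad_of_rel hR hT hb t hr hts⟩, hs, hr, hts⟩

theorem NAA.refines_of_prune {A : Type} {S T : NAA A}
    (h : T.Refines S.prune) : T.Refines S := by
  obtain ⟨R, hR, hi⟩ := h
  refine ⟨{p | ∃ hb : ¬ S.Bad p.2, (p.1, ⟨p.2, hb⟩) ∈ R}, ?_, ?_⟩
  · rintro ⟨t, s⟩ ⟨hb, hts⟩ M1 hM1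
    obtain ⟨_, ⟨M2, hM2, hg, rfl⟩, h1, h2⟩ := hR _ hts M1 hM1
    refine ⟨M2, hM2, ?_, ?_⟩
    · intro q hq
      obtain ⟨r, hr, he, hqr⟩ := h1 q hq
      exact ⟨(r.1, r.2.1), hr, he, r.2.2, hqr⟩
    · intro r hr
      obtain ⟨q, hq, he, hqr⟩ := h2 (r.1, ⟨r.2, hg r hr⟩) hr
      exact ⟨q, hq, he, hg r hr, hqr⟩
  · intro t ht
    obtain ⟨s, hs, hts⟩ := hi t ht
    exact ⟨s.1, hs, s.2, hts⟩

/-- for any NAA `S` and any locally consistent NAA `T`,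
`T ≤ₘ S` iff `T ≤ₘ ρ S`; in particular `⟦ρ S⟧ = ⟦S⟧`. -/
theorem statement19 (A : Type) [Fintype A] (S : NAA A) (hS : S.Wellformed) :
    (∀ T : NAA A, T.Wellformed → {t | T.Reach t}.Nonempty →
      (∀ t, T.Reach t → (T.Tran t).Nonempty) →
      (T.Refines S ↔ T.Refines S.prune)) ∧
    S.prune.impl = S.impl := by
  refine ⟨fun T _ _ hT => ⟨NAA.refines_prune hT, NAA.refines_of_prune⟩, ?_⟩
  ext I
  exact ⟨NAA.refines_of_prune, NAA.refines_prune fun t _ => ⟨_, rfl⟩⟩
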